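/- Let q ≥ 3 be a prime power, h ≥ 1 an integer, and l ≥ 1 an integer. Then the minimum distance satisfies d̄(q, (h+1)·l, h) = 2(q^{h+1} − 1)/(q − 1). -/

import Mathlib

/-- Base-`q` weight of a natural number: the number of nonzero digits in its
base-`q` expansion. -/
def wtq (q a : ℕ) : ℕ := ((Nat.digits q a).filter (fun d => d ≠ 0)).length

/-- `I(q,m,h)`: the set of integers `a` with `1 ≤ a ≤ q^m - 2` whose base-`q`
weight is at most `h`. -/
def Iset (q m h : ℕ) : Set ℕ := {a | 1 ≤ a ∧ a ≤ q ^ m - 2 ∧ wtq q a ≤ h}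

/-- Hamming weight of a coefficient vector: the number of nonzero coordinates. -/
noncomputable def hwt {R : Type*} [Zero R] {n : ℕ} (c : Fin n → R) : ℕ :=
  Set.ncard {i | c i ≠ 0}

/-- Membership in the code `Ω(q,m,h)` with respect to the primitive element `α`
of `L = F_{q^m}`: the polynomial `c(x) = ∑ c_i x^i` (coefficients in `K = F_q`)
vanishes at `α^a` for all `a ∈ I(q,m,h)`. -/
def inOmega {K L : Type*} [Field K] [Field L] [Algebra K L] (q m h : ℕ) (α : L)
    (c : Fin (q ^ m - 1) → K) : Prop :=
  ∀ a ∈ Iset q m h, ∑ i, algebraMap K L (c i) * α ^ (a * (i : ℕ)) = 0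

/-- Membership in the code `Ω̄(q,m,h)` with respect to the primitive element `α`
of `L = F_{q^m}`: the polynomial `c(x) = ∑ c_i x^i` (coefficients in `K = F_q`)
vanishes at `1` and at `α^a` and `α^{-a}` for all `a ∈ I(q,m,h)`. -/
def inOmegaBar {K L : Type*} [Field K] [Field L] [Algebra K L] (q m h : ℕ) (α : L)
    (c : Fin (q ^ m - 1) → K) : Prop :=
  (∑ i, algebraMap K L (c i) = 0) ∧
  ∀ a ∈ Iset q m h,
    (∑ i, algebraMap K L (c i) * α ^ (a * (i : ℕ)) = 0) ∧
    (∑ i, algebraMap K L (c i) * α⁻¹ ^ (a * (i : ℕ)) = 0)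

open Finset in
theorem sum_range_mul_eq {M : Type*} [AddCommMonoid M] (f : ℕ → M) (r d : ℕ) :
    ∑ i ∈ range (d * r), f i = ∑ k ∈ range d, ∑ j ∈ range r, f (r * k + j) := by
  induction d with
  | zero => simp
  | succ d ih => rw [sum_range_succ, ← ih, Nat.succ_mul, sum_range_add, mul_comm d r]

/-! ### Base-`q` weight -/

theorem wtq_zero (q : ℕ) : wtq q 0 = 0 := by simp [wtq]

theorem wtq_eq_div_add_mod {q : ℕ} (hq : 2 ≤ q) (n : ℕ) :
    wtq q n = wtq q (n / q) + if n % q = 0 then 0 else 1 := by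
  rcases Nat.eq_zero_or_pos n with rfl | hn
  · simp [wtq]
  · unfold wtq
    rw [Nat.digits_def' hq hn, List.filter_cons]
    by_cases h : n % q = 0 <;> simp [h]

theorem wtq_mul_add {q : ℕ} (hq : 2 ≤ q) (x : ℕ) {d : ℕ} (hd : d < q) :
    wtq q (q * x + d) = wtq q x + if d = 0 then 0 else 1 := by
  rw [wtq_eq_div_add_mod hq, Nat.mul_add_mod, Nat.mod_eq_of_lt hd,
    Nat.mul_add_div (by omega), Nat.div_eq_of_lt hd, add_zero]

theorem wtq_succ_le {q : ℕ} (hq : 2 ≤ q) (n : ℕ) : wtq q (n + 1) ≤ wtq q n + 1 := by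
  induction n using Nat.strong_induction_on with
  | _ n ih =>
    obtain ⟨x, d, hd, rfl⟩ : ∃ x d, d < q ∧ n = q * x + d :=
      ⟨n / q, n % q, Nat.mod_lt _ (by omega), (Nat.div_add_mod n q).symm⟩
    rw [wtq_mul_add hq x hd]
    rcases Nat.lt_or_ge (d + 1) q with h | h
    · rw [add_assoc, wtq_mul_add hq x h]
      split_ifs <;> omega
    · have hlt : x < q * x + d := by nlinarith
      have e : q * x + d + 1 = q * (x + 1) + 0 := by
        rw [mul_add]; omega
      rw [e, wtq_mul_add hq _ (by omega)]
      have := ih x hlt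
      split_ifs <;> omega

theorem wtq_add_le {q : ℕ} (hq : 2 ≤ q) (m n : ℕ) : wtq q (m + n) ≤ wtq q m + wtq q n := by
  induction m using Nat.strong_induction_on generalizing n with
  | _ m ih =>
    rcases Nat.eq_zero_or_pos m with rfl | hm
    · simp
    obtain ⟨x, d, hd, rfl⟩ : ∃ x d, d < q ∧ m = q * x + d :=
      ⟨m / q, m % q, Nat.mod_lt _ (by omega), (Nat.div_add_mod m q).symm⟩
    obtain ⟨y, e, he, rfl⟩ : ∃ x d, d < q ∧ n = q * x + d :=
      ⟨n / q, n % q, Nat.mod_lt _ (by omega), (Nat.div_add_mod n q).symm⟩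
    have hlt : x < q * x + d := by nlinarith
    have h1 := ih x hlt y
    rw [wtq_mul_add hq x hd, wtq_mul_add hq y he]
    rcases Nat.lt_or_ge (d + e) q with h | h
    · have : q * x + d + (q * y + e) = q * (x + y) + (d + e) := by ring
      rw [this, wtq_mul_add hq _ h]
      split_ifs <;> omega
    · have : q * x + d + (q * y + e) = q * (x + y + 1) + (d + e - q) := by
        rw [mul_add, mul_add]; omega
      rw [this, wtq_mul_add hq _ (by omega)]
      have h2 := wtq_succ_le hq (x + y)
      split_ifs <;> omega

theorem wtq_mul_pow_add {q : ℕ} (hq : 2 ≤ q) (x s : ℕ) {b : ℕ} (hb : b < q ^ s) :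
    wtq q (q ^ s * x + b) = wtq q x + wtq q b := by
  induction s generalizing b with
  | zero =>
    obtain rfl : b = 0 := by simpa using hb
    simp [wtq_zero]
  | succ s ih =>
    obtain ⟨y, d, hd, rfl⟩ : ∃ x d, d < q ∧ b = q * x + d :=
      ⟨b / q, b % q, Nat.mod_lt _ (by omega), (Nat.div_add_mod b q).symm⟩
    have hy : y < q ^ s := by
      rw [pow_succ'] at hb
      exact Nat.lt_of_mul_lt_mul_left (lt_of_le_of_lt (Nat.le_add_right _ _) hb)
    have : q ^ (s + 1) * x + (q * y + d) = q * (q ^ s * x + y) + d := by ring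
    rw [this, wtq_mul_add hq _ hd, wtq_mul_add hq _ hd, ih hy, add_assoc]

open Finset in
theorem geom_sum_succ_nat (q s : ℕ) :
    ∑ i ∈ range (s + 1), q ^ i = q * ∑ i ∈ range s, q ^ i + 1 := geom_sum_succ

open Finset in
theorem wtq_geom_sum_mul {q : ℕ} (hq : 2 ≤ q) (s : ℕ) {b : ℕ} (hb0 : 0 < b) (hb : b < q) :
    wtq q ((∑ i ∈ range s, q ^ i) * b) = s := by
  induction s with
  | zero => simp [wtq_zero]
  | succ s ih =>
    rw [geom_sum_succ_nat, add_mul, one_mul, mul_assoc, wtq_mul_add hq _ hb, ih,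
      if_neg hb0.ne']

open Finset in
/-- Integers below the least integer of weight `s + 1` have weight at most `s`. -/
theorem wtq_le_of_lt_geom_sum {q : ℕ} (hq : 2 ≤ q) (s : ℕ) {a : ℕ}
    (ha : a < ∑ i ∈ range (s + 1), q ^ i) : wtq q a ≤ s := by
  induction s generalizing a with
  | zero =>
    obtain rfl : a = 0 := by simpa using ha
    simp [wtq_zero]
  | succ s ih =>
    obtain ⟨x, d, hd, rfl⟩ : ∃ x d, d < q ∧ a = q * x + d :=
      ⟨a / q, a % q, Nat.mod_lt _ (by omega), (Nat.div_add_mod a q).symm⟩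
    rw [geom_sum_succ_nat] at ha
    rw [wtq_mul_add hq _ hd]
    rcases lt_or_ge x (∑ i ∈ range (s + 1), q ^ i) with hx | hx
    · have := ih hx
      split_ifs <;> omega
    · have h1 := Nat.mul_le_mul_left q hx
      obtain rfl : d = 0 := by omega
      have hx' : x = ∑ i ∈ range (s + 1), q ^ i :=
        le_antisymm (Nat.le_of_mul_le_mul_left (by omega : q * x ≤ _) (by omega)) hx
      have := wtq_geom_sum_mul hq (s + 1) (b := 1) one_pos (by omega)
      rw [mul_one, ← hx'] at this
      simp [this]

open Finset in
theorem geom_sum_mul_pred_add_one {q : ℕ} (hq : 2 ≤ q) (s : ℕ) :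
    (∑ i ∈ range s, q ^ i) * (q - 1) + 1 = q ^ s := by
  have h1 : 1 ≤ q ^ s := Nat.one_le_pow _ _ (by omega)
  have := geom_sum_mul_of_one_le (by omega : 1 ≤ q) s
  omega

open Finset in
/-- A positive multiple of `1 + q + ⋯ + q ^ (s - 1)` has weight at least `s`. -/
theorem le_wtq_of_geom_sum_dvd {q : ℕ} (hq : 2 ≤ q) {s : ℕ} (hs : 0 < s) {a : ℕ} (ha0 : 0 < a)
    (ha : (∑ i ∈ range s, q ^ i) ∣ a) : s ≤ wtq q a := by
  have hD := geom_sum_mul_pred_add_one hq s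
  induction a using Nat.strong_induction_on with
  | _ a ih =>
    rcases lt_or_ge a (q ^ s) with hlt | hge
    · obtain ⟨b, rfl⟩ := ha
      refine (wtq_geom_sum_mul hq s (Nat.pos_of_mul_pos_left ha0) ?_).ge
      by_contra! hb
      have h1 := Nat.mul_le_mul_left (∑ i ∈ range s, q ^ i) hb
      obtain ⟨p, rfl⟩ : ∃ p, q = p + 1 := ⟨q - 1, by omega⟩
      simp only [Nat.add_sub_cancel] at hD
      have := Nat.pos_of_mul_pos_right ha0
      rw [mul_add] at h1
      omega
    · obtain ⟨x, b, hb, rfl⟩ : ∃ x b, b < q ^ s ∧ a = q ^ s * x + b :=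
        ⟨a / q ^ s, a % q ^ s, Nat.mod_lt _ (by positivity), (Nat.div_add_mod a _).symm⟩
      have hx : 0 < x := by
        rcases Nat.eq_zero_or_pos x with rfl | h
        · omega
        · exact h
      have hqs : 2 ≤ q ^ s := hq.trans (Nat.le_self_pow hs.ne' q)
      have e : q ^ s * x + b = (∑ i ∈ range s, q ^ i) * ((q - 1) * x) + (x + b) := by
        rw [← hD]; ring
      rw [wtq_mul_pow_add hq x s hb]
      refine (ih (x + b) (by nlinarith) (by omega) ?_).trans (wtq_add_le hq x b)
      rw [e] at ha
      exact (Nat.dvd_add_right (dvd_mul_right _ _)).1 ha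

/-! ### The two bounds -/

open Polynomial in
/-- A nonzero vector annihilated by the powers `0, …, d - 1` of distinct points has more than `d`
nonzero coordinates. -/
theorem lt_card_of_forall_sum_mul_pow_eq_zero {ι F : Type*} [Field F]
    {x v : ι → F} {S : Finset ι} (hx : Set.InjOn x S) {d : ℕ}
    (hv : ∀ j < d, ∑ i ∈ S, v i * x i ^ j = 0) {k : ι} (hk : k ∈ S) (hvk : v k ≠ 0) :
    d < S.card := by
  classical
  by_contra! hd
  set p : F[X] := ∏ i ∈ S.erase k, (X - C (x i)) with hp
  have hdeg : p.natDegree < d := by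
    rw [hp, natDegree_prod_of_monic _ _ fun i _ => monic_X_sub_C _]
    simp only [natDegree_X_sub_C, Finset.sum_const, smul_eq_mul, mul_one]
    exact (Finset.card_erase_lt_of_mem hk).trans_le hd
  have hsum : ∑ i ∈ S, v i * p.eval (x i) = 0 := by
    simp_rw [eval_eq_sum_range' hdeg, Finset.mul_sum]
    rw [Finset.sum_comm]
    refine Finset.sum_eq_zero fun j hj => ?_
    rw [← mul_zero (p.coeff j), ← hv j (Finset.mem_range.1 hj), Finset.mul_sum]
    exact Finset.sum_congr rfl fun i _ => by ring
  rw [Finset.sum_eq_single_of_mem k hk] at hsum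
  · refine mul_ne_zero hvk ?_ hsum
    rw [hp, eval_prod, Finset.prod_ne_zero_iff]
    intro i hi
    obtain ⟨hne, hi⟩ := Finset.mem_erase.1 hi
    simpa [sub_eq_zero] using fun h => hne (hx hi hk h.symm)
  · intro i hi hne
    rw [hp, eval_prod, Finset.prod_eq_zero (Finset.mem_erase.2 ⟨hne, hi⟩) (by simp), mul_zero]

/-- The BCH bound for a zero set symmetric about `0`. -/
theorem two_mul_le_hwt {K L : Type*} [Field K] [Field L] [Algebra K L] {n D : ℕ} {α : L}
    (hα0 : α ≠ 0) (hα : orderOf α = n) {c : Fin n → K} (hc : c ≠ 0)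
    (hpos : ∀ a < D, ∑ i, algebraMap K L (c i) * α ^ (a * (i : ℕ)) = 0)
    (hneg : ∀ a < D, ∑ i, algebraMap K L (c i) * α⁻¹ ^ (a * (i : ℕ)) = 0) :
    2 * D ≤ hwt c := by
  classical
  obtain ⟨k, hk⟩ := Function.ne_iff.1 hc
  have hw : hwt c = (Finset.univ.filter fun i => c i ≠ 0).card := by
    rw [hwt, ← Set.ncard_coe_finset]; simp
  rcases Nat.eq_zero_or_pos D with rfl | hD
  · simp
  have := lt_card_of_forall_sum_mul_pow_eq_zero (S := Finset.univ.filter fun i => c i ≠ 0)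
    (x := fun i : Fin n => α ^ (i : ℕ))
    (v := fun i => algebraMap K L (c i) * α⁻¹ ^ ((D - 1) * (i : ℕ))) (d := 2 * D - 1) (k := k)
    ?_ ?_ (by simpa using hk) ?_
  · omega
  · intro i _ j _ hij
    exact Fin.ext (pow_injOn_Iio_orderOf (by simp [hα]) (by simp [hα]) hij)
  · intro j hj
    rw [Finset.sum_filter_of_ne (p := fun i => c i ≠ 0) fun i _ hi hci => hi (by simp [hci])]
    rcases le_total (D - 1) j with h | h
    · obtain ⟨a, rfl⟩ := Nat.exists_eq_add_of_le h
      rw [← hpos a (by omega)]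
      refine Finset.sum_congr rfl fun i _ => ?_
      rw [mul_assoc]
      congr 1
      rw [← pow_mul, mul_comm (i : ℕ), add_mul, pow_add, ← mul_assoc, ← mul_pow,
        inv_mul_cancel₀ hα0, one_pow, one_mul]
    · obtain ⟨a, ha⟩ := Nat.exists_eq_add_of_le h
      rw [← hneg a (by omega), ha]
      refine Finset.sum_congr rfl fun i _ => ?_
      rw [mul_assoc]
      congr 1
      rw [← pow_mul, mul_comm (i : ℕ), add_mul, pow_add, mul_right_comm, ← mul_pow,
        inv_mul_cancel₀ hα0, one_pow, one_mul]
  · exact mul_ne_zero (by simpa using hk) (pow_ne_zero _ (inv_ne_zero hα0))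

/-- The difference of the indicators of the residue classes `0` and `1` modulo `r`. -/
def cosetDiff (K : Type*) [Field K] (r i : ℕ) : K :=
  if i % r = 0 then 1 else if i % r = 1 then -1 else 0

theorem cosetDiff_mul_add (K : Type*) [Field K] (r k j : ℕ) :
    cosetDiff K r (r * k + j) = cosetDiff K r j := by
  simp [cosetDiff]

theorem sum_range_cosetDiff {K M : Type*} [Field K] [AddCommMonoid M] {r : ℕ} (hr : 2 ≤ r)
    (f : K → ℕ → M) (hf : ∀ i, f 0 i = 0) :
    ∑ i ∈ Finset.range r, f (cosetDiff K r i) i = f 1 0 + f (-1) 1 := by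
  have h0 : cosetDiff K r 0 = 1 := by simp [cosetDiff]
  have h1 : cosetDiff K r 1 = -1 := by simp [cosetDiff, Nat.mod_eq_of_lt (by omega : 1 < r)]
  rw [← Finset.sum_subset (Finset.range_subset_range.2 hr), Finset.sum_range_succ,
    Finset.sum_range_one, h0, h1]
  intro i hi hi2
  have hir := Finset.mem_range.1 hi
  have : cosetDiff K r i = 0 := by
    rw [Finset.mem_range] at hi2
    rw [cosetDiff, Nat.mod_eq_of_lt hir, if_neg (by omega), if_neg (by omega)]
  rw [this, hf]

theorem hwt_cosetDiff (K : Type*) [Field K] {D r : ℕ} (hr : 2 ≤ r) :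
    hwt (fun i : Fin (D * r) => cosetDiff K r i) = 2 * D := by
  classical
  have hw : hwt (fun i : Fin (D * r) => cosetDiff K r i) =
      ∑ i : Fin (D * r), if cosetDiff K r i ≠ 0 then 1 else 0 := by
    rw [← Finset.card_filter, hwt, ← Set.ncard_coe_finset]; simp
  rw [hw, Fin.sum_univ_eq_sum_range fun i => if cosetDiff K r i ≠ 0 then 1 else 0,
    sum_range_mul_eq]
  simp_rw [cosetDiff_mul_add]
  rw [sum_range_cosetDiff hr (fun z _ => if z ≠ 0 then 1 else 0) (by simp)]
  simp [mul_comm]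

theorem sum_cosetDiff_mul_pow (K : Type*) {L : Type*} [Field K] [Field L] [Algebra K L] {D r : ℕ}
    (hr : 2 ≤ r) (β : L) :
    ∑ i : Fin (D * r), algebraMap K L (cosetDiff K r i) * β ^ (i : ℕ) =
      (∑ k ∈ Finset.range D, (β ^ r) ^ k) * (1 - β) := by
  rw [Fin.sum_univ_eq_sum_range fun i => algebraMap K L (cosetDiff K r i) * β ^ i,
    sum_range_mul_eq, Finset.sum_mul]
  refine Finset.sum_congr rfl fun k _ => ?_
  simp_rw [cosetDiff_mul_add, pow_add, mul_left_comm _ (β ^ (r * k)), ← Finset.mul_sum]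
  rw [sum_range_cosetDiff hr (fun z i => algebraMap K L z * β ^ i) (by simp), pow_mul]
  simp [sub_eq_add_neg]

theorem sum_cosetDiff_mul_pow_eq_zero (K : Type*) {L : Type*} [Field K] [Field L] [Algebra K L]
    {D r a : ℕ} (hr : 2 ≤ r) {α : L} (hα : orderOf α = D * r) (ha : ¬ D ∣ a) :
    ∑ i : Fin (D * r), algebraMap K L (cosetDiff K r i) * α ^ (a * (i : ℕ)) = 0 := by
  simp_rw [pow_mul α a]
  rw [sum_cosetDiff_mul_pow K hr]
  have h1 : (α ^ a) ^ r ≠ 1 := by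
    rw [← pow_mul, Ne, ← orderOf_dvd_iff_pow_eq_one, hα]
    exact fun h => ha (Nat.dvd_of_mul_dvd_mul_right (by omega) h)
  have h2 : ((α ^ a) ^ r) ^ D = 1 := by
    rw [← pow_mul, ← pow_mul, ← orderOf_dvd_iff_pow_eq_one, hα]
    exact ⟨a, by ring⟩
  rw [geom_sum_eq h1, h2]
  simp

/-- For a prime power `q ≥ 3`, `h ≥ 1` and `l ≥ 1`, the minimum distance of
`Ω̄(q, (h+1)·l, h)` equals `2(q^{h+1} - 1)/(q - 1)`: it is the least Hamming weight of a
nonzero codeword. -/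
theorem stmt6 (q h l : ℕ) (hq : IsPrimePow q) (hq3 : 3 ≤ q) (hh : 1 ≤ h) (hl : 1 ≤ l)
    (K L : Type) [Field K] [Fintype K] [Field L] [Fintype L] [Algebra K L]
    (hcardK : Fintype.card K = q) (hcardL : Fintype.card L = q ^ ((h + 1) * l))
    (α : L) (hα : orderOf α = q ^ ((h + 1) * l) - 1) :
    IsLeast {w | ∃ c : Fin (q ^ ((h + 1) * l) - 1) → K,
        c ≠ 0 ∧ inOmegaBar q ((h + 1) * l) h α c ∧ hwt c = w}
      (2 * ((q ^ (h + 1) - 1) / (q - 1))) := by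
  have hq2 : 2 ≤ q := by omega
  rw [← Nat.geomSum_eq hq2]
  have hDq := geom_sum_mul_pred_add_one hq2 (h + 1)
  have hDpos : 0 < ∑ k ∈ Finset.range (h + 1), q ^ k := by
    rw [geom_sum_succ_nat]; omega
  have hwlt := fun a => wtq_le_of_lt_geom_sum hq2 h (a := a)
  have hwdvd := fun a => le_wtq_of_geom_sum_dvd hq2 h.succ_pos (a := a)
  generalize (∑ k ∈ Finset.range (h + 1), q ^ k) = D at *
  have hdvd : D ∣ q ^ ((h + 1) * l) - 1 := by
    refine dvd_trans ⟨q - 1, ?_⟩ (Nat.pow_sub_one_dvd_pow_sub_one q (Dvd.intro l rfl))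
    omega
  have hle : q ^ (h + 1) ≤ q ^ ((h + 1) * l) :=
    Nat.pow_le_pow_right (by omega) (Nat.le_mul_of_pos_right _ hl)
  have hDle : 2 * D ≤ D * (q - 1) := by
    rw [mul_comm 2]
    exact Nat.mul_le_mul_left D (by omega)
  have hα0 : α ≠ 0 := by
    rintro rfl
    rw [orderOf_zero] at hα
    omega
  constructor
  · unfold inOmegaBar Iset
    generalize q ^ ((h + 1) * l) = N at *
    obtain ⟨r, hr⟩ := hdvd
    have hr2 : 2 ≤ r := Nat.le_of_mul_le_mul_left (by rw [← hr]; omega : D * 2 ≤ D * r) hDpos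
    rw [hr] at hα ⊢
    refine ⟨fun i => cosetDiff K r i, ?_, ⟨?_, ?_⟩, hwt_cosetDiff K hr2⟩
    · intro h0
      have := hwt_cosetDiff K (D := D) hr2
      rw [h0] at this
      simp [hwt] at this
      omega
    · simpa using sum_cosetDiff_mul_pow K (D := D) hr2 (1 : L)
    · rintro a ⟨ha1, -, ha⟩
      have hnd : ¬ D ∣ a := fun hd => by
        have := hwdvd a ha1 hd
        omega
      exact ⟨sum_cosetDiff_mul_pow_eq_zero K hr2 hα hnd,
        sum_cosetDiff_mul_pow_eq_zero K hr2 (by rw [← hα, orderOf_eq_orderOf_iff]; simp) hnd⟩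
  · rintro w ⟨c, hc, ⟨h1, hI⟩, rfl⟩
    have hmem : ∀ a < D, a ≠ 0 → a ∈ Iset q ((h + 1) * l) h := fun a ha ha0 =>
      ⟨by omega, by omega, hwlt a ha⟩
    refine two_mul_le_hwt hα0 hα hc ?_ ?_
    · intro a ha
      rcases eq_or_ne a 0 with rfl | ha0
      · simpa using h1
      · exact (hI a (hmem a ha ha0)).1
    · intro a ha
      rcases eq_or_ne a 0 with rfl | ha0
      · simpa using h1
      · exact (hI a (hmem a ha ha0)).2
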